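/- Let V be a finite set, E a nonempty finite set of undirected edges on V, B ⊆ V, b : B → ℤ≥0, f an integer-valued biset function on V, and θ ≥ 2 an integer. Let x ∈ P(f,b,E) with 0 < x(e) < 1 for all e ∈ E, and suppose there exist a strongly laminar biset family L on V and C ⊆ B such that |L| + |C| = |E|, x(δ_E(Ŝ)) = f(Ŝ) ≥ 1 for all Ŝ ∈ L, x(δ_E(v)) = b(v) for all v ∈ C, and the incidence vectors in ℝ^E of the sets δ_E(Ŝ) for Ŝ ∈ L together with those of δ_E(v) for v ∈ C are linearly independent. Let 𝓔 be the set of leaves of L. If (θ−1)|𝓔| ≥ |C|, then there is an edge e ∈ E with x(e) ≥ 1/(2θ). -/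

import Mathlib

noncomputable section

attribute [local instance] Classical.propDecidable

/-- A biset on `V`: an ordered pair of finsets `inner ⊆ outer`. -/
structure Biset (V : Type*) where
  inner : Finset V
  outer : Finset V
  subset : inner ⊆ outer

namespace Biset

variable {V : Type*} [DecidableEq V]

instance [Fintype V] : Fintype (Biset V) :=
  Fintype.ofInjective (fun A => (A.inner, A.outer))
    (fun A B h => by
      cases A; cases B
      simp only [Prod.mk.injEq] at h
      cases h.1; cases h.2; rfl)

/-- The boundary `Γ(Ŝ) = S⁺ ∖ S`. -/
def boundary (A : Biset V) : Finset V := A.outer \ A.inner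

def inter (A B : Biset V) : Biset V :=
  ⟨A.inner ∩ B.inner, A.outer ∩ B.outer, Finset.inter_subset_inter A.subset B.subset⟩

def union (A B : Biset V) : Biset V :=
  ⟨A.inner ∪ B.inner, A.outer ∪ B.outer, Finset.union_subset_union A.subset B.subset⟩

def diff (A B : Biset V) : Biset V :=
  ⟨A.inner \ B.outer, A.outer \ B.inner, Finset.sdiff_subset_sdiff A.subset B.subset⟩

/-- Biset containment: `X̂ ⊆ Ŷ` iff `X ⊆ Y` and `X⁺ ⊆ Y⁺`. -/
def Sub (A B : Biset V) : Prop := A.inner ⊆ B.inner ∧ A.outer ⊆ B.outer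

def Laminar (L : Finset (Biset V)) : Prop :=
  ∀ A ∈ L, ∀ B ∈ L, Sub A B ∨ Sub B A ∨ A.inner ∩ B.inner = ∅

def StronglyLaminar (L : Finset (Biset V)) : Prop :=
  ∀ A ∈ L, ∀ B ∈ L, Sub A B ∨ Sub B A ∨
    (A.inner ∩ B.outer = ∅ ∧ B.inner ∩ A.outer = ∅)

def IntersectingSupermodular (f : Biset V → ℤ) : Prop :=
  ∀ A B : Biset V, (A.inner ∩ B.inner).Nonempty →
    f A + f B ≤ f (inter A B) + f (union A B)

def SkewSupermodular (f : Biset V → ℤ) : Prop :=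
  ∀ A B : Biset V,
    f A + f B ≤ f (inter A B) + f (union A B) ∨
    f A + f B ≤ f (diff A B) + f (diff B A)

def vertexBiset (v : V) : Biset V := ⟨{v}, {v}, Finset.Subset.refl _⟩

end Biset

/-- `γ = max { |Γ(Ŝ)| : f(Ŝ) > 0 }` (0 if no such biset exists). -/
def gammaOf {V : Type*} [Fintype V] [DecidableEq V] (f : Biset V → ℤ) : ℕ :=
  (Finset.univ.filter fun A : Biset V => 0 < f A).sup fun A => (Biset.boundary A).card

/-- The leaves (inclusion-minimal members) of a biset family. -/
def leaves {V : Type*} (L : Finset (Biset V)) : Finset (Biset V) :=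
  L.filter fun A => ∀ B ∈ L, Biset.Sub B A → B = A

/-- `max_{Ŝ ∈ L} |Γ(Ŝ)|` (0 if `L` is empty). -/
def gammaL {V : Type*} [DecidableEq V] (L : Finset (Biset V)) : ℕ :=
  L.sup fun A => (Biset.boundary A).card

section Undirected

variable {V E : Type*} [Fintype V] [DecidableEq V] [Fintype E]

/-- `δ_E(Ŝ)`: undirected edges covering the biset
(one end-node in the inner part, the other outside the outer part). -/
def uDelta (ep1 ep2 : E → V) (A : Biset V) : Finset E :=
  Finset.univ.filter fun e =>
    (ep1 e ∈ A.inner ∧ ep2 e ∉ A.outer) ∨ (ep2 e ∈ A.inner ∧ ep1 e ∉ A.outer)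

/-- `δ_E(v) = δ_E(({v},{v}))`. -/
def uDeg (ep1 ep2 : E → V) (v : V) : Finset E :=
  uDelta ep1 ep2 (Biset.vertexBiset v)

/-- The polytope `P(f,b,E)` for undirected edges. -/
def undirP (ep1 ep2 : E → V) (f : Biset V → ℤ) (B : Finset V) (b : V → ℕ) :
    Set (E → ℝ) :=
  {x | (∀ e : E, 0 ≤ x e ∧ x e ≤ 1) ∧
       (∀ A : Biset V, (f A : ℝ) ≤ ∑ e ∈ uDelta ep1 ep2 A, x e) ∧
       (∀ v ∈ B, ∑ e ∈ uDeg ep1 ep2 v, x e ≤ (b v : ℝ))}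

/-- Incidence vector of an edge set. -/
def incVec (F : Finset E) : E → ℝ := fun e => if e ∈ F then 1 else 0

end Undirected

namespace Biset

variable {V : Type*}

theorem Sub.refl (A : Biset V) : Sub A A := ⟨Finset.Subset.refl _, Finset.Subset.refl _⟩

theorem Sub.trans {A B D : Biset V} (h : Sub A B) (h' : Sub B D) : Sub A D :=
  ⟨h.1.trans h'.1, h.2.trans h'.2⟩

theorem Sub.antisymm {A B : Biset V} (hAB : Sub A B) (hBA : Sub B A) : A = B := by
  cases A; cases B
  simp only [mk.injEq]
  exact ⟨hAB.1.antisymm hBA.1, hAB.2.antisymm hBA.2⟩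

/-- `R` is a child of `S` in `L`: a maximal member of `L` properly contained in `S`. -/
def IsChild (L : Finset (Biset V)) (R S : Biset V) : Prop :=
  R ∈ L ∧ S ∈ L ∧ Sub R S ∧ R ≠ S ∧ ∀ T ∈ L, Sub R T → Sub T S → T = R ∨ T = S

/-- The children of `S` in `L`. -/
def children (L : Finset (Biset V)) (S : Biset V) : Finset (Biset V) :=
  L.filter fun R => IsChild L R S

/-- The inclusion-maximal members of `L`. -/
def roots (L : Finset (Biset V)) : Finset (Biset V) :=
  L.filter fun A => ∀ B ∈ L, Sub A B → B = A

theorem mem_children {L : Finset (Biset V)} {R S : Biset V} :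
    R ∈ children L S ↔ IsChild L R S := by
  simp only [children, Finset.mem_filter, and_iff_right_iff_imp]
  exact fun h => h.1

theorem mem_roots {L : Finset (Biset V)} {A : Biset V} :
    A ∈ roots L ↔ A ∈ L ∧ ∀ B ∈ L, Sub A B → B = A := by
  simp only [roots, Finset.mem_filter]

theorem mem_leaves {L : Finset (Biset V)} {A : Biset V} :
    A ∈ leaves L ↔ A ∈ L ∧ ∀ B ∈ L, Sub B A → B = A := by
  simp only [leaves, Finset.mem_filter]

theorem exists_isChild_of_notMem_roots {L : Finset (Biset V)} {R : Biset V} (hR : R ∈ L)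
    (h : R ∉ roots L) : ∃ S, IsChild L R S := by
  have hne : (L.filter fun A => Sub R A ∧ A ≠ R).Nonempty := by
    rw [mem_roots, not_and] at h
    have := h hR
    push Not at this
    obtain ⟨B, hB, hRB, hne⟩ := this
    exact ⟨B, by simp [hB, hRB, hne]⟩
  obtain ⟨S, hS, hmin⟩ := Finset.exists_min_image _
    (fun A : Biset V => A.inner.card + A.outer.card) hne
  simp only [Finset.mem_filter] at hS hmin
  refine ⟨S, hR, hS.1, hS.2.1, hS.2.2.symm, fun T hT hRT hTS => ?_⟩
  by_cases hTR : T = R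
  · exact Or.inl hTR
  · right
    have h1 := hmin T ⟨hT, hRT, hTR⟩
    have h2 := Finset.card_le_card hTS.1
    have h3 := Finset.card_le_card hTS.2
    exact Sub.antisymm hTS ⟨(Finset.eq_of_subset_of_card_le hTS.1 (by omega)).ge,
      (Finset.eq_of_subset_of_card_le hTS.2 (by omega)).ge⟩

theorem roots_nonempty {L : Finset (Biset V)} (h : L.Nonempty) : (roots L).Nonempty := by
  obtain ⟨S, hS, hmax⟩ := Finset.exists_max_image _
    (fun A : Biset V => A.inner.card + A.outer.card) h
  refine ⟨S, ?_⟩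
  rw [mem_roots]
  refine ⟨hS, fun T hT hST => ?_⟩
  have h1 := hmax T hT
  have h2 := Finset.card_le_card hST.1
  have h3 := Finset.card_le_card hST.2
  exact (Sub.antisymm hST ⟨(Finset.eq_of_subset_of_card_le hST.1 (by omega)).ge,
    (Finset.eq_of_subset_of_card_le hST.2 (by omega)).ge⟩).symm

variable [DecidableEq V]

theorem StronglyLaminar.comparable {L : Finset (Biset V)} (h : StronglyLaminar L)
    {A B : Biset V} (hA : A ∈ L) (hB : B ∈ L) {u : V} (hu : u ∈ A.inner) (hu' : u ∈ B.outer) :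
    Sub A B ∨ Sub B A := by
  rcases h A hA B hB with h | h | ⟨h, -⟩
  · exact Or.inl h
  · exact Or.inr h
  · have : u ∈ A.inner ∩ B.outer := Finset.mem_inter.2 ⟨hu, hu'⟩
    simp [h] at this

theorem StronglyLaminar.child_eq {L : Finset (Biset V)} (h : StronglyLaminar L)
    {R R' S : Biset V} (hR : IsChild L R S) (hR' : IsChild L R' S) {u : V}
    (hu : u ∈ R.inner) (hu' : u ∈ R'.inner) : R = R' := by
  rcases h.comparable hR.1 hR'.1 hu (R'.subset hu') with hs | hs
  · rcases hR.2.2.2.2 R' hR'.1 hs hR'.2.2.1 with h | h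
    · exact h.symm
    · exact absurd h hR'.2.2.2.1
  · rcases hR'.2.2.2.2 R hR.1 hs hR.2.2.1 with h | h
    · exact h
    · exact absurd h hR.2.2.2.1

theorem StronglyLaminar.root_eq {L : Finset (Biset V)} (h : StronglyLaminar L)
    {A B : Biset V} (hA : A ∈ roots L) (hB : B ∈ roots L) {u : V}
    (hu : u ∈ A.inner) (hu' : u ∈ B.inner) : A = B := by
  rw [mem_roots] at hA hB
  rcases h.comparable hA.1 hB.1 hu (B.subset hu') with hs | hs
  · exact (hA.2 B hB.1 hs).symm
  · exact hB.2 A hA.1 hs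

/-- The parents at which an edge stops covering a laminar chain starting at the same end-node
coincide. -/
theorem StronglyLaminar.parent_eq_of_same {L : Finset (Biset V)} (h : StronglyLaminar L)
    {R S R' S' : Biset V} (hR : IsChild L R S) (hR' : IsChild L R' S') {u v : V}
    (hu : u ∈ R.inner) (hvS : v ∈ S.outer)
    (hu' : u ∈ R'.inner) (hv' : v ∉ R'.outer) (hRR : Sub R R') :
    S = S' := by
  have huS := hR.2.2.1.1 hu
  have huS' := hR'.2.2.1.1 hu'
  have hR'S : Sub R' S := by
    rcases h.comparable hR'.1 hR.2.1 hu' (S.subset huS) with hs | hs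
    · exact hs
    · exact absurd (hs.2 hvS) hv'
  have hR'R : R' = R := by
    rcases hR.2.2.2.2 R' hR'.1 hRR hR'S with h | h
    · exact h
    · exact absurd (h ▸ hvS) hv'
  subst hR'R
  rcases h.comparable hR.2.1 hR'.2.1 huS (S'.subset huS') with hs | hs
  · rcases hR'.2.2.2.2 S hR.2.1 hR.2.2.1 hs with h | h
    · exact absurd h.symm hR.2.2.2.1
    · exact h
  · rcases hR.2.2.2.2 S' hR'.2.1 hR'.2.2.1 hs with h | h
    · exact absurd h.symm hR'.2.2.2.1
    · exact h.symm

theorem StronglyLaminar.parent_eq_of_opposite {L : Finset (Biset V)} (h : StronglyLaminar L)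
    {R S R' S' : Biset V} (hR : IsChild L R S) (hR' : IsChild L R' S') {u v : V}
    (hu : u ∈ R.inner) (hv : v ∉ R.outer) (hvS : v ∈ S.outer)
    (hv' : v ∈ R'.inner) (hu' : u ∉ R'.outer) (huS' : u ∈ S'.outer) :
    S = S' := by
  have huS := hR.2.2.1.1 hu
  have hvS' := hR'.2.2.1.1 hv'
  have hR'S : Sub R' S := by
    rcases h.comparable hR'.1 hR.2.1 hv' hvS with hs | hs
    · exact hs
    · exact absurd (hs.2 (S.subset huS)) hu'
  have hRS' : Sub R S' := by
    rcases h.comparable hR.1 hR'.2.1 hu huS' with hs | hs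
    · exact hs
    · exact absurd (hs.2 (S'.subset hvS')) hv
  rcases h.comparable hR.2.1 hR'.2.1 huS huS' with hs | hs
  · rcases hR'.2.2.2.2 S hR.2.1 hR'S hs with h | h
    · exact absurd (h ▸ S.subset huS) hu'
    · exact h
  · rcases hR.2.2.2.2 S' hR'.2.1 hRS' hs with h | h
    · exact absurd (h ▸ S'.subset hvS') hv
    · exact h.symm

end Biset

section Counting

open Biset

variable {V E : Type*}

/-- Summing a nonnegative weight minus that of the children telescopes to at most the roots. -/
theorem sum_sub_children_le {L : Finset (Biset V)} (g : Biset V → ℝ) (hg : ∀ A ∈ L, 0 ≤ g A) :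
    ∑ S ∈ L, (g S - ∑ R ∈ children L S, g R) ≤ ∑ M ∈ roots L, g M := by
  rw [Finset.sum_sub_distrib, sub_le_iff_le_add]
  simp only [children, roots, Finset.sum_filter]
  rw [Finset.sum_comm, ← Finset.sum_add_distrib]
  refine Finset.sum_le_sum fun R hR => ?_
  have hnn : ∀ S ∈ L, 0 ≤ if IsChild L R S then g R else 0 := fun S _ => by
    split_ifs
    · exact hg R hR
    · exact le_rfl
  split_ifs with h
  · exact le_add_of_nonneg_right (Finset.sum_nonneg hnn)
  · obtain ⟨S, hS⟩ := exists_isChild_of_notMem_roots hR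
      (fun h' => h (mem_roots.1 h').2)
    rw [zero_add]
    have := Finset.single_le_sum hnn hS.2.1
    rwa [if_pos hS] at this

theorem children_eq_empty_of_mem_leaves {L : Finset (Biset V)} {S : Biset V}
    (hS : S ∈ leaves L) : children L S = ∅ := by
  rw [Finset.eq_empty_iff_forall_notMem]
  intro R hR
  have hR := mem_children.1 hR
  exact hR.2.2.2.1 ((mem_leaves.1 hS).2 R hR.1 hR.2.2.1)

variable [Fintype E] [DecidableEq V] {ep1 ep2 : E → V}

theorem mem_uDelta {A : Biset V} {e : E} :
    e ∈ uDelta ep1 ep2 A ↔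
      (ep1 e ∈ A.inner ∧ ep2 e ∉ A.outer) ∨ (ep2 e ∈ A.inner ∧ ep1 e ∉ A.outer) := by
  simp [uDelta]

theorem sum_incVec (F : Finset (Biset V)) (e : E) :
    ∑ A ∈ F, incVec (uDelta ep1 ep2 A) e = ((F.filter fun A => e ∈ uDelta ep1 ep2 A).card : ℝ) := by
  simp only [incVec]
  exact Finset.sum_boole _ _

theorem sum_mul_incVec (x : E → ℝ) (F : Finset E) : ∑ e, x e * incVec F e = ∑ e ∈ F, x e := by
  simp [incVec]

theorem card_covered_le_two (F : Finset (Biset V))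
    (hF : ∀ A ∈ F, ∀ B ∈ F, ∀ u, u ∈ A.inner → u ∈ B.inner → A = B) (e : E) :
    (F.filter fun A => e ∈ uDelta ep1 ep2 A).card ≤ 2 := by
  refine le_trans (Finset.card_le_card_of_injOn
    (t := {ep1 e, ep2 e}) (fun A => if ep1 e ∈ A.inner then ep1 e else ep2 e) ?_ ?_)
    Finset.card_le_two
  · intro A _
    by_cases h : ep1 e ∈ A.inner <;> simp [h]
  · have key : ∀ A ∈ F.filter (fun A => e ∈ uDelta ep1 ep2 A),
        (if ep1 e ∈ A.inner then ep1 e else ep2 e) ∈ A.inner := by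
      intro A hA
      rw [Finset.mem_filter, mem_uDelta] at hA
      split_ifs with h
      · exact h
      · exact (hA.2.resolve_left fun h' => h h'.1).1
    intro A hA B hB hAB
    have hmemA := key A hA
    have hmemB := key B hB
    simp only at hAB
    rw [← hAB] at hmemB
    exact hF A (Finset.mem_filter.1 hA).1 B (Finset.mem_filter.1 hB).1 _ hmemA hmemB

/-- The edges that cover some child of `S` but not `S` itself. -/
def stopEdges (ep1 ep2 : E → V) (L : Finset (Biset V)) (S : Biset V) : Finset E :=
  Finset.univ.filter fun e =>
    e ∉ uDelta ep1 ep2 S ∧ ∃ R, IsChild L R S ∧ e ∈ uDelta ep1 ep2 R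

/-- The incidence of `S` at `e` minus the incidences of its children. -/
def excess (ep1 ep2 : E → V) (L : Finset (Biset V)) (S : Biset V) (e : E) : ℝ :=
  incVec (uDelta ep1 ep2 S) e - ∑ R ∈ children L S, incVec (uDelta ep1 ep2 R) e

theorem mem_stopEdges {L : Finset (Biset V)} {S : Biset V} {e : E} :
    e ∈ stopEdges ep1 ep2 L S ↔
      ∃ R, IsChild L R S ∧
        ((ep1 e ∈ R.inner ∧ ep2 e ∉ R.outer ∧ ep2 e ∈ S.outer) ∨
          (ep2 e ∈ R.inner ∧ ep1 e ∉ R.outer ∧ ep1 e ∈ S.outer)) ∧ e ∉ uDelta ep1 ep2 S := by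
  simp only [stopEdges, Finset.mem_filter, Finset.mem_univ, true_and]
  constructor
  · rintro ⟨h, R, hR, hRe⟩
    refine ⟨R, hR, ?_, h⟩
    rw [mem_uDelta] at h hRe
    push Not at h
    rcases hRe with ⟨h1, h2⟩ | ⟨h1, h2⟩
    · exact Or.inl ⟨h1, h2, h.1 (hR.2.2.1.1 h1)⟩
    · exact Or.inr ⟨h1, h2, h.2 (hR.2.2.1.1 h1)⟩
  · rintro ⟨R, hR, h, hS⟩
    refine ⟨hS, R, hR, mem_uDelta.2 ?_⟩
    tauto

theorem stopEdges_unique {L : Finset (Biset V)} (hlam : StronglyLaminar L) {S S' : Biset V}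
    {e : E} (h : e ∈ stopEdges ep1 ep2 L S) (h' : e ∈ stopEdges ep1 ep2 L S') : S = S' := by
  obtain ⟨R, hR, h, -⟩ := mem_stopEdges.1 h
  obtain ⟨R', hR', h', -⟩ := mem_stopEdges.1 h'
  have same : ∀ u v, u ∈ R.inner → v ∉ R.outer → v ∈ S.outer →
      u ∈ R'.inner → v ∉ R'.outer → v ∈ S'.outer → S = S' := by
    intro u v h1 h2 h3 h4 h5 h6
    rcases hlam.comparable hR.1 hR'.1 h1 (R'.subset h4) with hs | hs
    · exact hlam.parent_eq_of_same hR hR' h1 h3 h4 h5 hs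
    · exact (hlam.parent_eq_of_same hR' hR h4 h6 h1 h2 hs).symm
  rcases h with ⟨h1, h2, h3⟩ | ⟨h1, h2, h3⟩ <;> rcases h' with ⟨h4, h5, h6⟩ | ⟨h4, h5, h6⟩
  · exact same _ _ h1 h2 h3 h4 h5 h6
  · exact hlam.parent_eq_of_opposite hR hR' h1 h2 h3 h4 h5 h6
  · exact hlam.parent_eq_of_opposite hR hR' h1 h2 h3 h4 h5 h6
  · exact same _ _ h1 h2 h3 h4 h5 h6

theorem notMem_stopEdges_of_root {L : Finset (Biset V)} (hlam : StronglyLaminar L)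
    {M S : Biset V} {e : E} (hM : M ∈ roots L) (he : e ∈ uDelta ep1 ep2 M) :
    e ∉ stopEdges ep1 ep2 L S := by
  intro h
  obtain ⟨R, hR, h, -⟩ := mem_stopEdges.1 h
  rw [mem_roots] at hM
  have sub : ∀ u, u ∈ M.inner → u ∈ S.outer → Sub S M := by
    intro u hu hu'
    rcases hlam.comparable hM.1 hR.2.1 hu hu' with hs | hs
    · rw [hM.2 S hR.2.1 hs]
      exact Sub.refl M
    · exact hs
  have key : ∀ u v, u ∈ R.inner → v ∈ S.outer →
      ¬ ((u ∈ M.inner ∧ v ∉ M.outer) ∨ (v ∈ M.inner ∧ u ∉ M.outer)) := by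
    rintro u v hu hv (⟨h1, h2⟩ | ⟨h1, h2⟩)
    · exact h2 ((sub u h1 (hR.2.2.1.2 (R.subset hu))).2 hv)
    · exact h2 ((sub v h1 hv).2 (hR.2.2.1.2 (R.subset hu)))
  rw [mem_uDelta] at he
  rcases h with ⟨h1, -, h3⟩ | ⟨h1, -, h3⟩
  · exact key _ _ h1 h3 he
  · exact key _ _ h1 h3 he.symm

theorem card_children_covered_le_one {L : Finset (Biset V)} (hlam : StronglyLaminar L)
    {S : Biset V} {e : E} (he : e ∈ uDelta ep1 ep2 S) :
    ((children L S).filter fun R => e ∈ uDelta ep1 ep2 R).card ≤ 1 := by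
  rw [Finset.card_le_one]
  intro A hA B hB
  simp only [Finset.mem_filter, mem_children, mem_uDelta] at hA hB he
  have key : ∀ u v, u ∈ S.inner → v ∉ S.outer → ∀ D, IsChild L D S →
      ((u ∈ D.inner ∧ v ∉ D.outer) ∨ (v ∈ D.inner ∧ u ∉ D.outer)) → u ∈ D.inner := by
    rintro u v hu hv D hD (h | h)
    · exact h.1
    · exact absurd (S.subset (hD.2.2.1.1 h.1)) hv
  rcases he with he | he
  · exact hlam.child_eq hA.1 hB.1 (key _ _ he.1 he.2 A hA.1 hA.2) (key _ _ he.1 he.2 B hB.1 hB.2)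
  · exact hlam.child_eq hA.1 hB.1 (key _ _ he.1 he.2 A hA.1 hA.2.symm)
      (key _ _ he.1 he.2 B hB.1 hB.2.symm)

/-- The contribution of an edge to the tokens collected by `S` is nonnegative, and positive as
soon as the excess is nonzero. -/
theorem token_pos {L : Finset (Biset V)} (hlam : StronglyLaminar L) (S : Biset V) (e : E)
    {y : ℝ} (hy : 0 < y) (hy2 : 2 * y < 1) :
    0 ≤ y * excess ep1 ep2 L S e + incVec (stopEdges ep1 ep2 L S) e ∧
      (excess ep1 ep2 L S e ≠ 0 →
        0 < y * excess ep1 ep2 L S e + incVec (stopEdges ep1 ep2 L S) e) := by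
  rw [excess, sum_incVec]
  have h2 := card_covered_le_two (ep1 := ep1) (ep2 := ep2) (children L S)
    (fun A hA B hB u hu hu' => hlam.child_eq (mem_children.1 hA) (mem_children.1 hB) hu hu') e
  by_cases he : e ∈ uDelta ep1 ep2 S
  · have h1 := card_children_covered_le_one hlam he
    have hs : e ∉ stopEdges ep1 ep2 L S := by simp [stopEdges, he]
    generalize ((children L S).filter fun R => e ∈ uDelta ep1 ep2 R).card = k at *
    simp only [incVec, he, hs, if_true, if_false]
    interval_cases k <;> norm_num [hy, hy.le]
  · by_cases hs : e ∈ stopEdges ep1 ep2 L S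
    · generalize ((children L S).filter fun R => e ∈ uDelta ep1 ep2 R).card = k at *
      simp only [incVec, he, hs, if_true, if_false]
      have : 0 < y * (0 - (k : ℝ)) + 1 := by
        interval_cases k <;> norm_num <;> linarith
      exact ⟨this.le, fun _ => this⟩
    · have h0 : ((children L S).filter fun R => e ∈ uDelta ep1 ep2 R) = ∅ := by
        rw [Finset.filter_eq_empty_iff]
        intro R hR hRe
        exact hs (by
          simp only [stopEdges, Finset.mem_filter, Finset.mem_univ, true_and]
          exact ⟨he, R, mem_children.1 hR, hRe⟩)
      simp [incVec, he, hs, h0]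

theorem exists_excess_ne_zero {L : Finset (Biset V)}
    (hind : LinearIndependent ℝ (fun A : {A // A ∈ L} => incVec (uDelta ep1 ep2 A.1)))
    {S : Biset V} (hS : S ∈ L) : ∃ e, excess ep1 ep2 L S e ≠ 0 := by
  by_contra! h
  rw [Fintype.linearIndependent_iff] at hind
  have := hind (fun A => if A.1 = S then 1 else if A.1 ∈ children L S then -1 else 0) ?_ ⟨S, hS⟩
  · simp at this
  · funext e
    have hSc : S ∉ children L S := fun h => (mem_children.1 h).2.2.2.1 rfl
    simp only [Finset.sum_apply, Pi.smul_apply, smul_eq_mul, Pi.zero_apply]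
    refine Eq.trans ?_ (h e)
    rw [excess, Finset.univ_eq_attach, Finset.sum_attach L (fun A =>
      (if A = S then (1 : ℝ) else if A ∈ children L S then -1 else 0) *
        incVec (uDelta ep1 ep2 A) e)]
    have hsplit : ∀ A ∈ L, (if A = S then (1 : ℝ) else if A ∈ children L S then -1 else 0) *
        incVec (uDelta ep1 ep2 A) e = (if A = S then incVec (uDelta ep1 ep2 A) e else 0) -
          (if IsChild L A S then incVec (uDelta ep1 ep2 A) e else 0) := by
      intro A _
      by_cases hA : A = S
      · subst hA
        simp [mt mem_children.2 hSc]
      · by_cases hc : IsChild L A S <;> simp [hA, hc, mem_children]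
    rw [Finset.sum_congr rfl hsplit, Finset.sum_sub_distrib,
      ← Finset.sum_filter (fun A => IsChild L A S)]
    simp [hS, children]

theorem sum_excess (L : Finset (Biset V)) (S : Biset V) (x : E → ℝ) :
    ∑ e, x e * excess ep1 ep2 L S e =
      ∑ e ∈ uDelta ep1 ep2 S, x e - ∑ R ∈ children L S, ∑ e ∈ uDelta ep1 ep2 R, x e := by
  simp only [excess, mul_sub, Finset.sum_sub_distrib, sum_mul_incVec, Finset.mul_sum]
  rw [Finset.sum_comm]
  simp only [sum_mul_incVec]

/-- The tokens taken from an edge by the roots and by the sets where it stops covering. -/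
theorem edge_tokens {L : Finset (Biset V)} (hlam : StronglyLaminar L) (e : E)
    {y : ℝ} (hy : 0 < y) (hy2 : 2 * y < 1) :
    (∑ M ∈ roots L, y * incVec (uDelta ep1 ep2 M) e +
        ∑ S ∈ L, incVec (stopEdges ep1 ep2 L S) e ≤ 1) ∧
      ((∃ M ∈ roots L, e ∈ uDelta ep1 ep2 M) →
        ∑ M ∈ roots L, y * incVec (uDelta ep1 ep2 M) e +
          ∑ S ∈ L, incVec (stopEdges ep1 ep2 L S) e < 1) := by
  have hlt : (∃ M ∈ roots L, e ∈ uDelta ep1 ep2 M) →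
      ∑ M ∈ roots L, y * incVec (uDelta ep1 ep2 M) e +
        ∑ S ∈ L, incVec (stopEdges ep1 ep2 L S) e < 1 := by
    rintro ⟨M, hM, he⟩
    have h0 : ∑ S ∈ L, incVec (stopEdges ep1 ep2 L S) e = 0 :=
      Finset.sum_eq_zero fun S _ => by simp [incVec, notMem_stopEdges_of_root hlam hM he]
    have h2 : ((((roots L).filter fun A => e ∈ uDelta ep1 ep2 A).card : ℕ) : ℝ) ≤ 2 := by
      exact_mod_cast card_covered_le_two (ep1 := ep1) (ep2 := ep2) (roots L)
        (fun A hA B hB u hu hu' => hlam.root_eq hA hB hu hu') e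
    rw [h0, ← Finset.mul_sum, sum_incVec]
    nlinarith
  refine ⟨?_, hlt⟩
  by_cases h : ∃ M ∈ roots L, e ∈ uDelta ep1 ep2 M
  · exact (hlt h).le
  · push Not at h
    have h0 : ∑ M ∈ roots L, y * incVec (uDelta ep1 ep2 M) e = 0 :=
      Finset.sum_eq_zero fun M hM => by simp [incVec, h M hM]
    rw [h0, zero_add]
    simp only [incVec]
    rw [Finset.sum_boole]
    have : (L.filter fun S => e ∈ stopEdges ep1 ep2 L S).card ≤ 1 :=
      Finset.card_le_one.2 fun A hA B hB =>
        stopEdges_unique hlam (Finset.mem_filter.1 hA).2 (Finset.mem_filter.1 hB).2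
    exact_mod_cast this

end Counting

theorem stmt_9 {V E : Type*} [Fintype V] [DecidableEq V] [Fintype E] [Nonempty E]
    (ep1 ep2 : E → V) (B : Finset V) (b : V → ℕ)
    (f : Biset V → ℤ) (θ : ℤ) (hθ : 2 ≤ θ)
    (x : E → ℝ) (hx : x ∈ undirP ep1 ep2 f B b)
    (hx01 : ∀ e : E, 0 < x e ∧ x e < 1)
    (L : Finset (Biset V)) (C : Finset V)
    (hlam : Biset.StronglyLaminar L) (hCB : C ⊆ B)
    (hcard : L.card + C.card = Fintype.card E)
    (htight : ∀ A ∈ L, (∑ e ∈ uDelta ep1 ep2 A, x e) = (f A : ℝ) ∧ 1 ≤ f A)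
    (hdeg : ∀ v ∈ C, (∑ e ∈ uDeg ep1 ep2 v, x e) = (b v : ℝ))
    (hind : LinearIndependent ℝ (Sum.elim
      (fun A : {A // A ∈ L} => incVec (uDelta ep1 ep2 A.1))
      (fun v : {v // v ∈ C} => incVec (uDeg ep1 ep2 v.1))))
    (hEC : (C.card : ℤ) ≤ (θ - 1) * ((leaves L).card : ℤ)) :
    ∃ e : E, 1 / (2 * (θ : ℝ)) ≤ x e := by
  by_contra! hlt
  have hθ' : (2 : ℝ) ≤ θ := by exact_mod_cast hθ
  have hy : ∀ e, 0 < θ * x e := fun e => mul_pos (by linarith) (hx01 e).1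
  have hy2 : ∀ e, 2 * (θ * x e) < 1 := fun e => by
    have := hlt e
    rw [lt_div_iff₀ (by linarith)] at this
    linarith
  have hindL : LinearIndependent ℝ (fun A : {A // A ∈ L} => incVec (uDelta ep1 ep2 A.1)) :=
    hind.comp Sum.inl Sum.inl_injective
  set t : Biset V → ℤ := fun S =>
    θ * (f S - ∑ R ∈ Biset.children L S, f R) + (stopEdges ep1 ep2 L S).card with ht
  have htR : ∀ S ∈ L, (t S : ℝ) =
      ∑ e, (θ * x e * excess ep1 ep2 L S e + incVec (stopEdges ep1 ep2 L S) e) := by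
    intro S hS
    have h1 : ∑ e, incVec (stopEdges ep1 ep2 L S) e = ((stopEdges ep1 ep2 L S).card : ℝ) := by
      simp [incVec]
    have h2 : ∑ R ∈ Biset.children L S, ∑ e ∈ uDelta ep1 ep2 R, x e =
        ∑ R ∈ Biset.children L S, (f R : ℝ) :=
      Finset.sum_congr rfl fun R hR => (htight R (Biset.mem_children.1 hR).1).1
    simp only [mul_assoc, Finset.sum_add_distrib]
    rw [← Finset.mul_sum, sum_excess, h1, h2, (htight S hS).1, ht]
    push_cast
    ring
  have ht1 : ∀ S ∈ L, 1 ≤ t S := by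
    intro S hS
    have : (0 : ℝ) < t S := by
      rw [htR S hS]
      obtain ⟨e, he⟩ := exists_excess_ne_zero hindL hS
      exact Finset.sum_pos' (fun e _ => (token_pos hlam S e (hy e) (hy2 e)).1)
        ⟨e, Finset.mem_univ e, (token_pos hlam S e (hy e) (hy2 e)).2 he⟩
    have : 0 < t S := by exact_mod_cast this
    omega
  have hleaf : ∀ S ∈ leaves L, θ ≤ t S := by
    intro S hS
    have hf := (htight S (Biset.mem_leaves.1 hS).1).2
    simp only [ht, children_eq_empty_of_mem_leaves hS, Finset.sum_empty, sub_zero]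
    nlinarith
  have hlow : (L.card : ℤ) + (θ - 1) * (leaves L).card ≤ ∑ S ∈ L, t S := by
    have : ∑ S ∈ L, (1 + if S ∈ leaves L then θ - 1 else 0) ≤ ∑ S ∈ L, t S := by
      refine Finset.sum_le_sum fun S hS => ?_
      split_ifs with h
      · linarith [hleaf S h]
      · linarith [ht1 S hS]
    have hfl : L.filter (· ∈ leaves L) = leaves L := by
      ext S
      simp only [Biset.mem_leaves, Finset.mem_filter]
      tauto
    rw [Finset.sum_add_distrib, ← Finset.sum_filter, hfl] at this
    simp only [Finset.sum_const, nsmul_eq_mul, mul_one] at this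
    linarith
  have hE : (Fintype.card E : ℤ) ≤ ∑ S ∈ L, t S := by
    rw [← hcard]
    push_cast
    linarith
  have hL : L.Nonempty := by
    by_contra h
    rw [Finset.not_nonempty_iff_eq_empty] at h
    have : (Fintype.card E : ℤ) ≤ 0 := by simpa only [h, Finset.sum_empty] using hE
    have := Fintype.card_pos (α := E)
    omega
  have hup : ((∑ S ∈ L, t S : ℤ) : ℝ) ≤
      ∑ e, (∑ M ∈ Biset.roots L, θ * x e * incVec (uDelta ep1 ep2 M) e +
        ∑ S ∈ L, incVec (stopEdges ep1 ep2 L S) e) := by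
    have hsum : ∀ S ∈ L, (t S : ℝ) = ((θ : ℝ) * f S - ∑ R ∈ Biset.children L S, (θ : ℝ) * f R) +
        ∑ e, incVec (stopEdges ep1 ep2 L S) e := by
      intro S _
      rw [← Finset.mul_sum]
      simp only [ht, incVec]
      push_cast
      simp
      ring
    have hnn : ∀ S ∈ L, 0 ≤ (θ : ℝ) * f S := fun S hS => by
      have : (1 : ℝ) ≤ f S := by exact_mod_cast (htight S hS).2
      nlinarith
    have hroots : ∑ M ∈ Biset.roots L, (θ : ℝ) * f M =
        ∑ e, ∑ M ∈ Biset.roots L, θ * x e * incVec (uDelta ep1 ep2 M) e := by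
      rw [Finset.sum_comm]
      refine Finset.sum_congr rfl fun M hM => ?_
      rw [sum_mul_incVec, ← Finset.mul_sum, (htight M (Biset.mem_roots.1 hM).1).1]
    push_cast
    rw [Finset.sum_congr rfl hsum, Finset.sum_add_distrib, Finset.sum_add_distrib, ← hroots,
      Finset.sum_comm (s := L)]
    exact add_le_add_left (sum_sub_children_le _ hnn) _
  obtain ⟨M, hM⟩ := Biset.roots_nonempty hL
  have hne : (uDelta ep1 ep2 M).Nonempty := by
    by_contra h
    rw [Finset.not_nonempty_iff_eq_empty] at h
    obtain ⟨h1, h2⟩ := htight M (Biset.mem_roots.1 hM).1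
    rw [h, Finset.sum_empty] at h1
    have : f M = 0 := by exact_mod_cast h1.symm
    omega
  obtain ⟨e₀, he₀⟩ := hne
  have hstrict : ∑ e, (∑ M ∈ Biset.roots L, θ * x e * incVec (uDelta ep1 ep2 M) e +
      ∑ S ∈ L, incVec (stopEdges ep1 ep2 L S) e) < ∑ _e : E, (1 : ℝ) :=
    Finset.sum_lt_sum (fun e _ => (edge_tokens hlam e (hy e) (hy2 e)).1)
      ⟨e₀, Finset.mem_univ _, (edge_tokens hlam e₀ (hy e₀) (hy2 e₀)).2 ⟨M, hM, he₀⟩⟩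
  have hER : (Fintype.card E : ℝ) ≤ ((∑ S ∈ L, t S : ℤ) : ℝ) := by exact_mod_cast hE
  simp only [Finset.sum_const, Finset.card_univ, nsmul_eq_mul, mul_one] at hstrict
  linarith
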